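/- Let α₁, α₂ be real numbers with 0 < α₁ < Q and 0 < α₂ < Q, and let α = α₁+α₂. Then ∫_{ℝ^{2n+1}} ∫_{ℝ^{2n+1}} |y₁|_h^{-α₁} |y₂|_h^{-α₂} / [max(1, |y₁|_h^Q, |y₂|_h^Q)]² dy₁ dy₂ = 2Qω_Q² / (α(Q-α₁)(Q-α₂)). -/

import Mathlib

open MeasureTheory ENNReal

/-- The Korányi (homogeneous) norm on the Heisenberg group `ℍⁿ ≃ ℝ^{2n+1}`. -/
noncomputable def hnorm (n : ℕ) (x : Fin (2*n+1) → ℝ) : ℝ :=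
  ((∑ i : Fin (2*n+1), if (i : ℕ) < 2*n then (x i)^2 else 0)^2
    + (x (Fin.last (2*n)))^2) ^ ((1:ℝ)/4)

/-- The Heisenberg dilations `δ_r`. -/
noncomputable def dil (n : ℕ) (r : ℝ) (x : Fin (2*n+1) → ℝ) : Fin (2*n+1) → ℝ :=
  fun i => if (i : ℕ) < 2*n then r * x i else r^2 * x i

/-- The norm of the weighted-type space `H^∞_α(ℍⁿ)`:
`‖f‖ = ess sup_x |x|_h^α |f x|`. -/
noncomputable def wnorm (n : ℕ) (α : ℝ) (f : (Fin (2*n+1) → ℝ) → ℝ) : ℝ≥0∞ :=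
  essSup (fun x => ENNReal.ofReal (hnorm n x ^ α * |f x|)) volume

/-- `Ω_Q`: the volume of the Korányi unit ball. -/
noncomputable def ΩQ (n : ℕ) : ℝ :=
  (volume {x : Fin (2*n+1) → ℝ | hnorm n x < 1}).toReal


lemma hnorm_nonneg' (n : ℕ) (x) : 0 ≤ hnorm n x := by
  unfold hnorm; positivity

lemma hnorm_cont (n : ℕ) : Continuous (hnorm n) := by
  unfold hnorm
  refine Continuous.rpow_const ?_ (fun x => Or.inr (by norm_num))
  refine Continuous.add (Continuous.pow (continuous_finset_sum _ fun i _ => ?_) 2) (by fun_prop)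
  split_ifs <;> fun_prop

lemma hnorm_dil (n : ℕ) (r : ℝ) (hr : 0 < r) (x) : hnorm n (dil n r x) = r * hnorm n x := by
  unfold hnorm dil
  have h1 : (∑ i : Fin (2*n+1), if (i : ℕ) < 2*n then ((if (i : ℕ) < 2*n then r * x i else r^2 * x i))^2 else 0)
     = r^2 * ∑ i : Fin (2*n+1), if (i : ℕ) < 2*n then (x i)^2 else 0 := by
    rw [Finset.mul_sum]
    refine Finset.sum_congr rfl fun i _ => ?_
    split_ifs <;> ring
  rw [h1]
  simp only [Fin.val_last, lt_irrefl, if_false]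
  rw [show ∀ S t : ℝ, (r^2*S)^2 + (r^2*t)^2 = r^4 * (S^2+t^2) by intros; ring]
  rw [Real.mul_rpow (by positivity) (by positivity)]
  congr 1
  rw [← Real.rpow_natCast, ← Real.rpow_mul hr.le]; norm_num

lemma vol_dil (n : ℕ) (r : ℝ) (hr : 0 < r) (S : Set (Fin (2*n+1) → ℝ)) :
    volume (dil n r ⁻¹' S) = ENNReal.ofReal ((r^(2*n+2))⁻¹) * volume S := by
  let D : Fin (2*n+1) → ℝ := fun i => if (i : ℕ) < 2*n then r else r^2
  let f := Matrix.toLin' (Matrix.diagonal D)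
  have hd : dil n r = f := by
    ext x i
    simp only [f, Matrix.toLin'_apply, Matrix.mulVec_diagonal, dil, D]
    split_ifs <;> rfl
  have hdet : LinearMap.det f = r^(2*n+2) := by
    simp only [f, LinearMap.det_toLin', Matrix.det_diagonal, D]
    rw [Fin.prod_univ_castSucc]
    simp; ring
  rw [hd, Measure.addHaar_preimage_linearMap volume (by rw [hdet]; positivity), hdet, abs_of_pos (by positivity)]

lemma vol_ball_lt_top (n : ℕ) : volume {x : Fin (2*n+1) → ℝ | hnorm n x < 1} < ⊤ := by
  refine lt_of_le_of_lt (measure_mono (t := Metric.closedBall 0 1) ?_) measure_closedBall_lt_top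
  intro x hx
  have hx : hnorm n x < 1 := hx
  rw [mem_closedBall_zero_iff, pi_norm_le_iff_of_nonneg zero_le_one]
  unfold hnorm at hx
  set S := ∑ i : Fin (2*n+1), if (i : ℕ) < 2*n then (x i)^2 else 0 with hS
  have h0 : ∀ i : Fin (2*n+1), 0 ≤ if (i : ℕ) < 2*n then (x i)^2 else 0 := by
    intro i; split_ifs <;> positivity
  have hS0 : 0 ≤ S := Finset.sum_nonneg fun i _ => h0 i
  have hF : S^2 + (x (Fin.last (2*n)))^2 < 1 := by
    by_contra! h
    exact absurd hx (not_lt.2 (Real.one_le_rpow h (by norm_num)))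
  intro i
  rw [Real.norm_eq_abs, ← sq_le_one_iff_abs_le_one]
  by_cases hi : (i : ℕ) < 2*n
  · have := Finset.single_le_sum (fun i _ => h0 i) (Finset.mem_univ i)
    simp only [hi, if_true] at this
    rw [← hS] at this
    nlinarith [sq_nonneg (x (Fin.last (2*n)))]
  · have : i = Fin.last _ := by ext; simp; omega
    rw [this]; nlinarith

lemma vol_N (n : ℕ) (Q : ℝ) (hQ : Q = 2*n+2) (b : ℝ) (hb : 0 ≤ b) :
    volume {x : Fin (2*n+1) → ℝ | hnorm n x ^ Q < b} = ENNReal.ofReal (ΩQ n) * ENNReal.ofReal b := by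
  rcases hb.eq_or_lt with rfl | hb
  · have : {x : Fin (2*n+1) → ℝ | hnorm n x ^ Q < 0} = ∅ := by
      ext x; simpa using Real.rpow_nonneg (hnorm_nonneg' n x) _
    simp [this]
  have hQ0 : 0 < Q := by rw [hQ]; positivity
  set s : ℝ := (b⁻¹) ^ (Q⁻¹) with hs
  have hs0 : 0 < s := by positivity
  have hsQ : s ^ Q = b⁻¹ := by rw [hs, Real.rpow_inv_rpow (by positivity) hQ0.ne']
  have hsQ' : s ^ (2*n+2) = b⁻¹ := by
    rw [← hsQ, ← Real.rpow_natCast, hQ]; push_cast; rfl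
  have : {x : Fin (2*n+1) → ℝ | hnorm n x ^ Q < b} = dil n s ⁻¹' {x | hnorm n x < 1} := by
    ext x
    simp only [Set.mem_setOf_eq, Set.mem_preimage, hnorm_dil n s hs0]
    have h0 := hnorm_nonneg' n x
    rw [← Real.rpow_lt_rpow_iff (by positivity) zero_le_one hQ0, Real.mul_rpow hs0.le h0, hsQ,
      Real.one_rpow, inv_mul_lt_iff₀ hb, mul_one]
  rw [this, vol_dil n s hs0, hsQ', inv_inv, ΩQ, ENNReal.ofReal_toReal (vol_ball_lt_top n).ne, mul_comm]

lemma map_N (n : ℕ) (Q : ℝ) (hQ : Q = 2*n+2) :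
    Measure.map (fun x => hnorm n x ^ Q) volume
      = ENNReal.ofReal (ΩQ n) • (volume : Measure ℝ).restrict (Set.Ioi 0) := by
  have hQ0 : 0 < Q := by rw [hQ]; positivity
  have hm : Measurable (fun x => hnorm n x ^ Q) := (hnorm_cont n).measurable.pow_const _
  have hI : ∀ b : ℝ, Measure.map (fun x => hnorm n x ^ Q) volume (Set.Iio b) =
      ENNReal.ofReal (ΩQ n) * ENNReal.ofReal b := by
    intro b
    rw [Measure.map_apply hm measurableSet_Iio]
    rcases le_total 0 b with h | h
    · exact vol_N n Q hQ b h
    · have : (fun x => hnorm n x ^ Q) ⁻¹' (Set.Iio b) = ∅ := by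
        ext x; simpa using h.trans (Real.rpow_nonneg (hnorm_nonneg' n x) _)
      simp [this, ENNReal.ofReal_of_nonpos h]
  have hJ : ∀ b : ℝ, (ENNReal.ofReal (ΩQ n) • (volume : Measure ℝ).restrict (Set.Ioi 0)) (Set.Iio b) =
      ENNReal.ofReal (ΩQ n) * ENNReal.ofReal b := by
    intro b
    rw [Measure.smul_apply, Measure.restrict_apply measurableSet_Iio, Set.inter_comm, Set.Ioi_inter_Iio, Real.volume_Ioo]
    simp
  have key : ∀ (μ : Measure ℝ), (∀ b : ℝ, μ (Set.Iio b) = ENNReal.ofReal (ΩQ n) * ENNReal.ofReal b) →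
     ∀ a b : ℝ, a < b → μ (Set.Ico a b) = ENNReal.ofReal (ΩQ n) * ENNReal.ofReal b - ENNReal.ofReal (ΩQ n) * ENNReal.ofReal a := by
    intro μ hμ a b hab
    rw [← hμ, ← hμ, ← measure_diff (Set.Iio_subset_Iio hab.le) measurableSet_Iio.nullMeasurableSet
      (by rw [hμ]; exact ENNReal.mul_ne_top ENNReal.ofReal_ne_top ENNReal.ofReal_ne_top)]
    congr 1
    ext x; simp [and_comm]
  refine Measure.ext_of_Ico' _ _ (fun {a b} hab => ?_) (fun {a b} hab => ?_)
  · rw [key _ hI a b hab]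
    exact ENNReal.sub_ne_top (ENNReal.mul_ne_top ENNReal.ofReal_ne_top ENNReal.ofReal_ne_top)
  · rw [key _ hI a b hab, key _ hJ a b hab]

lemma oneD (a k M : ℝ) (hM : 0 < M) (ha : a < 1) (hk : 1 < a + k) :
    IntegrableOn (fun v : ℝ => v ^ (-a) * (max M v) ^ (-k)) (Set.Ioi 0) ∧
    ∫ v in Set.Ioi (0:ℝ), v ^ (-a) * (max M v) ^ (-k) = M ^ (1 - a - k) * (1/(1-a) + 1/(a+k-1)) := by
  have hu : Set.Ioi (0:ℝ) = Set.Ioc 0 M ∪ Set.Ioi M := (Set.Ioc_union_Ioi_eq_Ioi hM.le).symm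
  have e1 : Set.EqOn (fun v : ℝ => v ^ (-a) * (max M v) ^ (-k)) (fun v => v ^ (-a) * M ^ (-k)) (Set.Ioc 0 M) := by
    intro v hv
    simp only [max_eq_left hv.2]
  have e2 : Set.EqOn (fun v : ℝ => v ^ (-a) * (max M v) ^ (-k)) (fun v => v ^ (-a-k)) (Set.Ioi M) := by
    intro v hv
    have hv : M < v := hv
    simp only [max_eq_right hv.le]
    rw [← Real.rpow_add (hM.trans hv), sub_eq_add_neg]
  have i1 : IntegrableOn (fun v : ℝ => v ^ (-a) * (max M v) ^ (-k)) (Set.Ioc 0 M) := by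
    rw [integrableOn_congr_fun e1 measurableSet_Ioc]
    have := intervalIntegral.intervalIntegrable_rpow' (r := -a) (a := 0) (b := M) (by linarith)
    rw [intervalIntegrable_iff_integrableOn_Ioc_of_le hM.le] at this
    exact this.mul_const _
  have i2 : IntegrableOn (fun v : ℝ => v ^ (-a) * (max M v) ^ (-k)) (Set.Ioi M) := by
    rw [integrableOn_congr_fun e2 measurableSet_Ioi]
    exact integrableOn_Ioi_rpow_of_lt (by linarith) hM
  refine ⟨hu ▸ i1.union i2, ?_⟩
  rw [hu, setIntegral_union (Set.Ioc_disjoint_Ioi le_rfl) measurableSet_Ioi i1 i2,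
    setIntegral_congr_fun measurableSet_Ioc e1, setIntegral_congr_fun measurableSet_Ioi e2,
    integral_Ioi_rpow_of_lt (by linarith) hM, integral_mul_const,
    ← intervalIntegral.integral_of_le hM.le, integral_rpow (Or.inl (by linarith)),
    Real.zero_rpow (by linarith), show -a + 1 = 1 - a by ring, show -a - k + 1 = 1 - a - k by ring,
    show 1 - a - k = (1 - a) + (-k) by ring, Real.rpow_add hM]
  have h1 : 1 - a ≠ 0 := by linarith
  have h2 : a + k - 1 ≠ 0 := by linarith
  have h3 : 1 - a + -k ≠ 0 := by linarith
  rw [show 1 - a + -k = -(a+k-1) by ring]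
  field_simp
  ring

lemma twoD (a b : ℝ) (ha : 0 < a) (ha1 : a < 1) (hb : 0 < b) (hb1 : b < 1) :
    ∫ p : ℝ × ℝ, p.1 ^ (-a) * p.2 ^ (-b) / (max 1 (max p.1 p.2)) ^ 2
      ∂((volume.restrict (Set.Ioi 0)).prod (volume.restrict (Set.Ioi 0)))
    = 2 / ((a+b) * (1-a) * (1-b)) := by
  set μ := (volume : Measure ℝ).restrict (Set.Ioi 0) with hμ
  have hG : ∀ u v : ℝ, u ^ (-a) * v ^ (-b) / (max 1 (max u v)) ^ 2
      = u ^ (-a) * (v ^ (-b) * (max (max 1 u) v) ^ (-2:ℝ)) := by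
    intro u v
    have : 0 < max (max 1 u) v := by simp
    rw [Real.rpow_neg this.le, Real.rpow_two, max_assoc]
    ring
  have hin : ∀ u : ℝ, ∫ v, u ^ (-a) * v ^ (-b) / (max 1 (max u v)) ^ 2 ∂μ
      = (u ^ (-a) * (max 1 u) ^ (-(1+b))) * (1/(1-b) + 1/(b+2-1)) := by
    intro u
    simp_rw [hG]
    rw [integral_const_mul, hμ, (oneD b 2 (max 1 u) (by simp) hb1 (by linarith)).2,
      show 1 - b - 2 = -(1+b) by ring]
    ring
  have hout := oneD a (1+b) 1 one_pos ha1 (by linarith)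
  have hint : Integrable (fun p : ℝ × ℝ => p.1 ^ (-a) * p.2 ^ (-b) / (max 1 (max p.1 p.2)) ^ 2) (μ.prod μ) := by
    rw [integrable_prod_iff (Measurable.aestronglyMeasurable (by fun_prop))]
    constructor
    · refine Filter.Eventually.of_forall fun u => ?_
      simp only [hG]
      exact (oneD b 2 (max 1 u) (by simp) hb1 (by linarith)).1.const_mul _
    · have : Integrable (fun u => (u ^ (-a) * (max 1 u) ^ (-(1+b))) * (1/(1-b) + 1/(b+2-1))) μ :=
        hout.1.mul_const _
      refine this.congr ?_
      filter_upwards [ae_restrict_mem measurableSet_Ioi] with u hu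
      rw [← hin]
      refine integral_congr_ae ?_
      filter_upwards [ae_restrict_mem measurableSet_Ioi] with v hv
      have hu : 0 < u := hu
      have hv : 0 < v := hv
      rw [Real.norm_of_nonneg (by positivity)]
  rw [integral_prod _ hint]
  simp_rw [hin]
  rw [integral_mul_const, hout.2, Real.one_rpow]
  have h1 : 1 - a ≠ 0 := by linarith
  have h2 : 1 - b ≠ 0 := by linarith
  rw [show a + (1+b) - 1 = a + b by ring, show b + 2 - 1 = 1 + b by ring]
  field_simp
  ring

theorem statement13 (n : ℕ) (hn : 1 ≤ n)
    (Q : ℝ) (hQ : Q = 2*n+2) (ω : ℝ) (hω : ω = Q * ΩQ n)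
    (α₁ α₂ : ℝ) (hα₁ : 0 < α₁) (hα₁Q : α₁ < Q) (hα₂ : 0 < α₂) (hα₂Q : α₂ < Q)
    (α : ℝ) (hα : α = α₁ + α₂) :
    (∫ p : (Fin (2*n+1) → ℝ) × (Fin (2*n+1) → ℝ),
        hnorm n p.1 ^ (-α₁) * hnorm n p.2 ^ (-α₂) /
          (max 1 (max (hnorm n p.1 ^ Q) (hnorm n p.2 ^ Q))) ^ 2)
      = 2 * Q * ω ^ 2 / (α * (Q - α₁) * (Q - α₂)) := by
  have hQ0 : 0 < Q := by rw [hQ]; positivity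
  have hm : Measurable (fun x => hnorm n x ^ Q) := (hnorm_cont n).measurable.pow_const _
  have hp : ∀ (β : ℝ) x, hnorm n x ^ (-β) = (hnorm n x ^ Q) ^ (-(β / Q)) := by
    intro β x
    rw [← Real.rpow_mul (hnorm_nonneg' n x)]
    congr 1; field_simp
  have hmap := Measure.map_prod_map (volume : Measure (Fin (2*n+1) → ℝ)) (volume : Measure (Fin (2*n+1) → ℝ)) hm hm
  rw [map_N n Q hQ] at hmap
  have h2 := twoD (α₁/Q) (α₂/Q) (by positivity) ((div_lt_one hQ0).2 hα₁Q) (by positivity) ((div_lt_one hQ0).2 hα₂Q)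
  simp_rw [hp α₁, hp α₂]
  have h3 := integral_map (μ := (volume : Measure (Fin (2*n+1) → ℝ)).prod (volume : Measure (Fin (2*n+1) → ℝ)))
    (hm.prodMap hm).aemeasurable
    (f := fun p : ℝ × ℝ => p.1 ^ (-(α₁/Q)) * p.2 ^ (-(α₂/Q)) / (max 1 (max p.1 p.2)) ^ 2)
    (Measurable.aestronglyMeasurable (by fun_prop))
  rw [← hmap] at h3
  simp only [Prod.map_fst, Prod.map_snd] at h3
  rw [Measure.volume_eq_prod, ← h3, Measure.prod_smul_left, Measure.prod_smul_right,
    integral_smul_measure, integral_smul_measure, h2]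
  have hΩ : 0 ≤ ΩQ n := ENNReal.toReal_nonneg
  rw [ENNReal.toReal_ofReal hΩ, hω, hα]
  have h4 : Q - α₁ ≠ 0 := by linarith
  have h5 : Q - α₂ ≠ 0 := by linarith
  have h6 : α₁ + α₂ ≠ 0 := by linarith
  simp only [smul_eq_mul]
  field_simp
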